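/- Fix an integer S ≥ 1. Let a : ℕ → ℝ with a_i ≥ 0 and Σ_{i=0}^{∞} a_i = 1, extended by a_k = 0 for k < 0, and let q : ℕ → ℝ with q_i ≥ 0 and Σ_{i=0}^{∞} q_i = 1 satisfy the balance equations q_j = a_j·(Σ_{i=0}^{S} q_i) + Σ_{i=S+1}^{∞} q_i·a_{j−i+S} for all j ∈ ℕ. Define A(z) = Σ_{i=0}^{∞} a_i z^i, Q(z) = Σ_{i=0}^{∞} q_i z^i, and T(z) = z^S·Σ_{i=0}^{S−1} q_i + Σ_{i=S}^{∞} q_i z^i. Then for every z ∈ ℂ with 0 < |z| < 1, Q(z) = z^{−S}·A(z)·T(z). -/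

import Mathlib

/-- Extension of a sequence on ℕ to ℤ by zero on negative integers. -/
def aext (a : ℕ → ℝ) : ℤ → ℝ := fun k => if 0 ≤ k then a k.toNat else 0

/-- If q is a stationary distribution of the queue recursion
(balance equations q_j = a_j Σ_{i=0}^{S} q_i + Σ_{i=S+1}^∞ q_i a_{j−i+S}),
then for 0 < |z| < 1, Q(z) = z^{−S} A(z) T(z). -/
theorem Q_eq_zpow_mul_A_mul_T
    (S : ℕ) (hS : 1 ≤ S)
    (a : ℕ → ℝ) (ha_nonneg : ∀ i, 0 ≤ a i) (ha_sum : HasSum a 1)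
    (q : ℕ → ℝ) (hq_nonneg : ∀ i, 0 ≤ q i) (hq_sum : HasSum q 1)
    (h_balance : ∀ j : ℕ,
      q j = a j * (∑ i ∈ Finset.range (S + 1), q i) +
        ∑' i : ℕ, if S + 1 ≤ i then q i * aext a ((j : ℤ) - (i : ℤ) + (S : ℤ)) else 0) :
    ∀ z : ℂ, 0 < ‖z‖ → ‖z‖ < 1 →
      (∑' i : ℕ, (q i : ℂ) * z ^ i) =
        z ^ (-(S : ℤ)) * (∑' i : ℕ, (a i : ℂ) * z ^ i) *
          (z ^ S * (∑ i ∈ Finset.range S, (q i : ℂ)) +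
            ∑' i : ℕ, if S ≤ i then (q i : ℂ) * z ^ i else 0) := by
  intro z hz0 hz1
  have hz : z ≠ 0 := norm_pos_iff.mp hz0
  have hzle : ∀ n : ℕ, ‖z ^ n‖ ≤ 1 := fun n => by
    rw [norm_pow]; exact pow_le_one₀ (norm_nonneg _) hz1.le
  have hsum : ∀ f : ℕ → ℝ, (∀ i, 0 ≤ f i) → Summable f →
      Summable (fun i => ‖(f i : ℂ) * z ^ i‖) := by
    intro f hf hs
    refine Summable.of_nonneg_of_le (fun _ => norm_nonneg _) (fun i => ?_) hs
    rw [norm_mul, Complex.norm_real, Real.norm_of_nonneg (hf i)]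
    exact mul_le_of_le_one_right (hf i) (hzle i)
  set c : ℝ := ∑ i ∈ Finset.range S, q i with hc
  have hc0 : 0 ≤ c := Finset.sum_nonneg fun i _ => hq_nonneg i
  set u : ℕ → ℝ := fun m => q (m + S) with hu
  set d : ℕ → ℝ := fun m => if m = 0 then c else 0 with hd
  set t : ℕ → ℝ := fun m => d m + u m with ht
  have hus : Summable u := (summable_nat_add_iff S).2 hq_sum.summable
  have hds : Summable d := (hasSum_ite_eq 0 c).summable
  have hts : Summable t := hds.add hus
  have hu0 : ∀ i, 0 ≤ u i := fun i => hq_nonneg _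
  have hd0 : ∀ i, 0 ≤ d i := fun i => by simp only [hd]; split_ifs <;> simp [hc0]
  have ht0 : ∀ i, 0 ≤ t i := fun i => add_nonneg (hd0 i) (hu0 i)
  have hconv : ∀ j, q j = ∑ m ∈ Finset.range (j + 1), t m * a (j - m) := by
    intro j
    rw [h_balance j, tsum_eq_sum (s := Finset.range (S + (j + 1)))]
    · rw [Finset.sum_range_succ q S, Finset.sum_range_add _ S (j + 1),
        Finset.sum_eq_zero (s := Finset.range S) (f := fun i => if S + 1 ≤ i then
          q i * aext a ((j : ℤ) - (i : ℤ) + (S : ℤ)) else 0), zero_add, Finset.sum_range_succ' _ j,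
        Finset.sum_range_succ' _ j]
      · have h1 : ∀ m ∈ Finset.range j, (if S + 1 ≤ S + (m + 1) then q (S + (m + 1)) *
            aext a ((j : ℤ) - ((S + (m + 1) : ℕ) : ℤ) + (S : ℤ)) else 0)
            = t (m + 1) * a (j - (m + 1)) := by
          intro m hm
          have hm := Finset.mem_range.mp hm
          have e : (j : ℤ) - ((S + (m + 1) : ℕ) : ℤ) + (S : ℤ) = ((j - (m + 1) : ℕ) : ℤ) := by
            omega
          rw [e, if_pos (by omega)]
          simp [aext, ht, hd, hu, add_comm S]
        rw [Finset.sum_congr rfl h1]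
        simp [ht, hd, hu, ← hc]
        ring
      · intro i hi
        have := Finset.mem_range.mp hi
        rw [if_neg (by omega)]
    · intro i hi
      have : S + (j + 1) ≤ i := by simpa using hi
      split_ifs
      · rw [aext, if_neg (by omega), mul_zero]
      · rfl
  have hprod := tsum_mul_tsum_eq_tsum_sum_range_of_summable_norm
    (hsum t ht0 hts) (hsum a ha_nonneg ha_sum.summable)
  have hQ : (∑' i : ℕ, (q i : ℂ) * z ^ i) =
      (∑' i : ℕ, (t i : ℂ) * z ^ i) * ∑' i : ℕ, (a i : ℂ) * z ^ i := by
    rw [hprod]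
    refine tsum_congr fun j => ?_
    rw [hconv j]
    push_cast
    rw [Finset.sum_mul]
    refine Finset.sum_congr rfl fun m hm => ?_
    have hm := Finset.mem_range.mp hm
    have e : z ^ j = z ^ m * z ^ (j - m) := by rw [← pow_add]; congr 1; omega
    rw [e]; ring
  have hT1 : (∑' i : ℕ, (t i : ℂ) * z ^ i) = (c : ℂ) + ∑' i : ℕ, (u i : ℂ) * z ^ i := by
    have h2 : (∑' i : ℕ, (d i : ℂ) * z ^ i) = c := by
      rw [tsum_eq_single 0]
      · simp [hd]
      · intro b hb; simp [hd, hb]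
    rw [← h2, ← (hsum d hd0 hds).of_norm.tsum_add (hsum u hu0 hus).of_norm]
    refine tsum_congr fun i => ?_
    simp only [ht]; push_cast; ring
  have hT2 : (∑' i : ℕ, if S ≤ i then (q i : ℂ) * z ^ i else 0)
      = z ^ S * ∑' i : ℕ, (u i : ℂ) * z ^ i := by
    have hs : Summable (fun i : ℕ => if S ≤ i then (q i : ℂ) * z ^ i else 0) := by
      refine Summable.of_norm_bounded (hsum q hq_nonneg hq_sum.summable) fun i => ?_
      split_ifs <;> simp
      positivity
    rw [← hs.sum_add_tsum_nat_add S, Finset.sum_eq_zero, zero_add, ← tsum_mul_left]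
    · refine tsum_congr fun i => ?_
      rw [if_pos (by omega), pow_add]; simp only [hu]; ring
    · intro i hi
      have := Finset.mem_range.mp hi
      rw [if_neg (by omega)]
  have hcc : (∑ i ∈ Finset.range S, (q i : ℂ)) = (c : ℂ) := by rw [hc]; push_cast; rfl
  rw [hQ, hT1, hT2, hcc, zpow_neg, zpow_natCast]
  have := pow_ne_zero S hz
  field_simp
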